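/- Characterization of representatives of the anchored spectral tail process: Let Y be a tail process with index α > 0 and finitely many exceedance-points (i.e. Y is a random element of ℝ₀^{ℤ^d} satisfying the tail-process identity, |Y_0| is Pareto(α)-distributed and independent of the spectral process Θ = Y/|Y_0|, and P(Θ ∈ l₀) = 1), set ϑ := E[1/|e(Y)|], and let Q = (Q_i)_{i∈ℤ^d} be a random element of l₀ with ‖Q‖ = 1 a.s. and E[Σ_{k∈ℤ^d} |Q_k|^α] < ∞. The following are equivalent: (i) Q is a representative of the anchored spectral tail process; (ii) E[h(Θ)] = (1/E[Σ_{k∈ℤ^d}|Q_k|^α]) · E[Σ_{k∈ℤ^d} h(θ_k Q/|Q_k|) |Q_k|^α] for every measurable h : l₀ → [0,∞); (iii) E[h(Q)] = ϑ^{−1} E[ h(Θ/‖Θ‖) · ‖Θ‖^α / Σ_{k∈ℤ^d}|Θ_k|^α ] for every shift-invariant measurable h : l₀ → [0,∞). -/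

import Mathlib

open MeasureTheory ENNReal Filter ProbabilityTheory

noncomputable section

/-- The space `ℝ^{ℤ^d}` of real-valued fields indexed by `ℤ^d`. -/
abbrev RField (d : ℕ) := (Fin d → ℤ) → ℝ

variable {d : ℕ}

/-- Shift operator: `shift k x = (x_{i+k})_i`, i.e. it moves the origin to `k`. -/
def shift (k : Fin d → ℤ) (x : RField d) : RField d := fun i => x (i + k)

/-- The set of exceedance-points of `x`. -/
def excSet (x : RField d) : Set (Fin d → ℤ) := {k | 1 < |x k|}

open Classical in
/-- Indicator (with values in `ℝ≥0∞`) of the event that `|x k| > s`. -/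
def exIndGT (s : ℝ) (k : Fin d → ℤ) (x : RField d) : ℝ≥0∞ := if s < |x k| then 1 else 0

/-- The tail-process identity:
`E[h(θ_k Y) 1{|Y_k| > 1}] = E[h(Y) 1{|Y_{−k}| > 1}]` for every measurable nonnegative `h`
and every `k ∈ ℤ^d`. -/
def TailIdentity {Ω : Type*} [MeasurableSpace Ω] (μ : Measure Ω) (Y : Ω → RField d) : Prop :=
  ∀ h : RField d → ℝ≥0∞, Measurable h → ∀ k : Fin d → ℤ,
    ∫⁻ ω, h (shift k (Y ω)) * exIndGT 1 k (Y ω) ∂μ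
      = ∫⁻ ω, h (Y ω) * exIndGT 1 (-k) (Y ω) ∂μ

/-- `Y` is exceedance-stationary: for every exceedance-map `τ` which is bijective on a
measurable set `B` (invariant under shifting the origin to exceedance-points, contained in
`ℝ₀^{ℤ^d}`) carrying the law of `Y`, we have `θ_τ Y ≐ Y`. -/
def ExcStationary {Ω : Type*} [MeasurableSpace Ω] (μ : Measure Ω) (Y : Ω → RField d) : Prop :=
  ∀ (B : Set (RField d)) (τ : RField d → Fin d → ℤ),
    MeasurableSet B → Measurable τ →
    (∀ x ∈ B, 1 < |x 0|) →
    (∀ x ∈ B, ∀ k ∈ excSet x, shift k x ∈ B) →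
    (∀ x ∈ B, τ x ∈ excSet x) →
    (∀ x ∈ B, Set.BijOn (fun k => k + τ (shift k x)) (excSet x) (excSet x)) →
    (∀ᵐ ω ∂μ, Y ω ∈ B) →
    Measure.map (fun ω => shift (τ (Y ω)) (Y ω)) μ = Measure.map Y μ

/-- `E₀`: elements of `ℝ₀^{ℤ^d}` with finitely many exceedance-points. -/
def E0set (d : ℕ) : Set (RField d) := {x | 1 < |x 0| ∧ (excSet x).Finite}

/-- `E`: elements of `ℝ^{ℤ^d}` with at least one but finitely many exceedance-points. -/
def Eset (d : ℕ) : Set (RField d) := {x | (excSet x).Nonempty ∧ (excSet x).Finite}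

/-- `l₀`: fields vanishing at infinity. -/
def l0set (d : ℕ) : Set (RField d) := {x | Tendsto (fun i => |x i|) cofinite (nhds 0)}

/-- Uniform norm `‖x‖ = sup_i |x_i|`. -/
def supNorm (x : RField d) : ℝ := ⨆ i, |x i|

/-- `V` is Pareto(α)-distributed: `P(V > y) = y^{-α}` for `y ≥ 1`. -/
def IsPareto {Ω : Type*} [MeasurableSpace Ω] (μ : Measure Ω) (V : Ω → ℝ) (α : ℝ) : Prop :=
  ∀ y : ℝ, 1 ≤ y → μ {ω | y < V ω} = ENNReal.ofReal (y ^ (-α))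

/-- An anchoring function on `S`: a measurable shift-covariant exceedance-map. -/
def IsAnchoringOn (S : Set (RField d)) (A : RField d → Fin d → ℤ) : Prop :=
  Measurable A ∧ ∀ x ∈ S, A x ∈ excSet x ∧ ∀ k ∈ excSet x, A (shift k x) + k = A x

/-- `h` is shift-invariant on `S`. -/
def ShiftInvariantOn (S : Set (RField d)) (h : RField d → ℝ≥0∞) : Prop :=
  ∀ x ∈ S, ∀ k : Fin d → ℤ, h (shift k x) = h x

/-- Data of a first-maximum anchoring function `A^{fm}`: a translation-invariant linear
(group) order `r` on `ℤ^d`, and a measurable map `Afm` which picks, for every nonzero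
`x ∈ l₀`, the `r`-smallest index at which `|x|` attains its maximum `‖x‖`. -/
structure FirstMaxData (d : ℕ) where
  r : (Fin d → ℤ) → (Fin d → ℤ) → Prop
  Afm : RField d → Fin d → ℤ
  r_linear : IsLinearOrder (Fin d → ℤ) r
  r_add_invariant : ∀ a b c : Fin d → ℤ, r a b → r (a + c) (b + c)
  meas : Measurable Afm
  mem_argmax : ∀ x ∈ l0set d, x ≠ 0 → |x (Afm x)| = supNorm x
  min_argmax : ∀ x ∈ l0set d, x ≠ 0 → ∀ k : Fin d → ℤ, |x k| = supNorm x → r (Afm x) k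

/-- `Q` (a random element of `l₀` on `(Ω₂, μ₂)`) is a representative of the anchored spectral
tail process of `Θ`: `E[h(Q)] = E[h(Θ) | A^{fm}(Θ) = 0]` for every shift-invariant
measurable `h : l₀ → [0,∞)`. -/
def IsSpectralRep {Ω : Type*} [MeasurableSpace Ω] (μ : Measure Ω) (Θ : Ω → RField d)
    (F : FirstMaxData d) {Ω₂ : Type*} [MeasurableSpace Ω₂] (μ₂ : Measure Ω₂)
    (Q : Ω₂ → RField d) : Prop :=
  ∀ h : RField d → ℝ≥0∞, Measurable h → ShiftInvariantOn (l0set d) h →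
    ∫⁻ ω, h (Q ω) ∂μ₂
      = ∫⁻ x, h x ∂(ProbabilityTheory.cond (Measure.map Θ μ) {x | F.Afm x = 0})

lemma supNorm_shift (k : Fin d → ℤ) (x : RField d) : supNorm (shift k x) = supNorm x :=
  (Equiv.addRight k).iSup_comp (g := fun i => |x i|)

lemma supNorm_smul {c : ℝ} (hc : 0 ≤ c) (x : RField d) : supNorm (c • x) = c * supNorm x := by
  simp only [supNorm, Pi.smul_apply, smul_eq_mul, abs_mul, abs_of_nonneg hc]
  exact (Real.mul_iSup_of_nonneg hc _).symm

lemma shift_mem_l0set {x : RField d} (hx : x ∈ l0set d) (k : Fin d → ℤ) : shift k x ∈ l0set d :=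
  Tendsto.comp hx (Equiv.addRight k).injective.tendsto_cofinite

lemma smul_mem_l0set {x : RField d} (hx : x ∈ l0set d) (c : ℝ) : c • x ∈ l0set d := by
  have h : Tendsto (fun i => |x i|) cofinite (nhds 0) := hx
  simpa [l0set, abs_mul] using h.const_mul |c|

lemma isCountablyGenerated_cofinite (ι : Type*) [Countable ι] :
    (cofinite : Filter ι).IsCountablyGenerated :=
  HasCountableBasis.isCountablyGenerated ⟨hasBasis_cofinite, Set.Countable.ofPred_finite⟩

lemma measurableSet_l0set : MeasurableSet (l0set d) :=
  have := isCountablyGenerated_cofinite (Fin d → ℤ)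
  measurableSet_tendsto (l := cofinite) (nhds 0) (f := fun i (x : RField d) => |x i|)
    fun i => (measurable_pi_apply i).abs

lemma shift_add (j k : Fin d → ℤ) (x : RField d) : shift j (shift k x) = shift (j + k) x := by
  ext i; simp [shift, add_assoc]

lemma shift_smul (k : Fin d → ℤ) (c : ℝ) (x : RField d) : shift k (c • x) = c • shift k x := rfl

lemma measurable_shift (k : Fin d → ℤ) : Measurable (shift (d := d) k) :=
  measurable_pi_lambda _ fun i => measurable_pi_apply (i + k)

lemma measurable_supNorm : Measurable (supNorm (d := d)) :=
  Measurable.iSup fun i => (measurable_pi_apply i).abs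

lemma bddAbove_of_mem_l0set {x : RField d} (hx : x ∈ l0set d) :
    BddAbove (Set.range fun i => |x i|) :=
  Tendsto.bddAbove_range_of_cofinite hx

lemma abs_le_supNorm {x : RField d} (hx : x ∈ l0set d) (k : Fin d → ℤ) : |x k| ≤ supNorm x :=
  le_ciSup (bddAbove_of_mem_l0set hx) k

lemma FirstMaxData.eq_of_argmax (F : FirstMaxData d) {x : RField d} (hx : x ∈ l0set d)
    (hx0 : x ≠ 0) {m : Fin d → ℤ} (hm : |x m| = supNorm x)
    (hmin : ∀ k, |x k| = supNorm x → F.r m k) : F.Afm x = m :=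
  F.r_linear.antisymm _ _ (F.min_argmax x hx hx0 m hm) (hmin _ (F.mem_argmax x hx hx0))

lemma FirstMaxData.Afm_smul_shift (F : FirstMaxData d) {x : RField d} (hx : x ∈ l0set d)
    (hx0 : x ≠ 0) {c : ℝ} (hc : 0 < c) (k : Fin d → ℤ) :
    F.Afm (c • shift k x) = F.Afm x - k := by
  have key : ∀ m, |(c • shift k x) m| = supNorm (c • shift k x) ↔ |x (m + k)| = supNorm x := by
    intro m
    rw [supNorm_smul hc.le, supNorm_shift]
    simp [shift, abs_mul, abs_of_pos hc, hc.ne']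
  apply F.eq_of_argmax (smul_mem_l0set (shift_mem_l0set hx k) c)
  · intro h
    apply hx0
    ext i
    have := congrFun h (i - k)
    simpa [shift, hc.ne'] using this
  · rw [key, sub_add_cancel]
    exact F.mem_argmax x hx hx0
  · intro j hj
    have := F.r_add_invariant _ _ (-k) (F.min_argmax x hx hx0 _ ((key j).1 hj))
    simpa [sub_eq_add_neg] using this

lemma FirstMaxData.Afm_smul (F : FirstMaxData d) {x : RField d} (hx : x ∈ l0set d)
    (hx0 : x ≠ 0) {c : ℝ} (hc : 0 < c) : F.Afm (c • x) = F.Afm x := by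
  have h : shift 0 x = x := by ext; simp [shift]
  simpa [h] using F.Afm_smul_shift hx hx0 hc 0

lemma FirstMaxData.apply_Afm_ne_zero (F : FirstMaxData d) {x : RField d} (hx : x ∈ l0set d)
    (hx0 : x ≠ 0) : x (F.Afm x) ≠ 0 := by
  obtain ⟨i, hi⟩ := Function.ne_iff.1 hx0
  have h := abs_le_supNorm hx i
  rw [← F.mem_argmax x hx hx0] at h
  exact abs_pos.1 ((abs_pos.2 hi).trans_le h)

lemma FirstMaxData.measurableSet_Afm_eq (F : FirstMaxData d) (k : Fin d → ℤ) :
    MeasurableSet {x | F.Afm x = k} :=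
  F.meas (measurableSet_singleton k)

/-- The field `x` recentered at `k` and normalized to have modulus one at the origin. -/
def recenter (k : Fin d → ℤ) (x : RField d) : RField d := |x k|⁻¹ • shift k x

lemma measurable_recenter (k : Fin d → ℤ) : Measurable (recenter (d := d) k) :=
  (measurable_pi_apply k).abs.inv.smul (measurable_shift k)

lemma measurable_ofReal_abs_rpow (α : ℝ) (k : Fin d → ℤ) :
    Measurable fun x : RField d => ENNReal.ofReal (|x k| ^ α) :=
  ((measurable_pi_apply k).abs.pow_const α).ennreal_ofReal

/-- The sum of the values of `h` over all recentered versions of `x`, with weights `|x_k|^α`. -/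
def recenterSum (α : ℝ) (h : RField d → ℝ≥0∞) (x : RField d) : ℝ≥0∞ :=
  ∑' k : Fin d → ℤ, ENNReal.ofReal (|x k| ^ α) * h (recenter k x)

/-- The sum `∑ₖ |x_k|^α`. -/
def powSum (α : ℝ) (x : RField d) : ℝ≥0∞ := ∑' k : Fin d → ℤ, ENNReal.ofReal (|x k| ^ α)

lemma measurable_recenterSum (α : ℝ) {h : RField d → ℝ≥0∞} (hh : Measurable h) :
    Measurable (recenterSum α h) :=
  Measurable.tsum fun k =>
    (measurable_ofReal_abs_rpow α k).mul (hh.comp (measurable_recenter k))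

lemma measurable_powSum (α : ℝ) : Measurable (powSum (d := d) α) :=
  Measurable.tsum fun k => measurable_ofReal_abs_rpow α k

lemma recenterSum_one (α : ℝ) (x : RField d) : recenterSum α 1 x = powSum α x := by
  simp [recenterSum, powSum]

lemma recenterSum_shift (α : ℝ) (h : RField d → ℝ≥0∞) (j : Fin d → ℤ) (x : RField d) :
    recenterSum α h (shift j x) = recenterSum α h x := by
  unfold recenterSum
  simp only [recenter, shift_add]
  exact (Equiv.addRight j).tsum_eq fun k => ENNReal.ofReal (|x k| ^ α) * h (|x k|⁻¹ • shift k x)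

lemma powSum_shift (α : ℝ) (k : Fin d → ℤ) (x : RField d) :
    powSum α (shift k x) = powSum α x := by
  rw [← recenterSum_one, recenterSum_shift, recenterSum_one]

lemma powSum_smul (α : ℝ) {c : ℝ} (hc : 0 ≤ c) (x : RField d) :
    powSum α (c • x) = ENNReal.ofReal (c ^ α) * powSum α x := by
  simp only [powSum, ← ENNReal.tsum_mul_left]
  refine tsum_congr fun k => ?_
  rw [← ENNReal.ofReal_mul (by positivity), ← Real.mul_rpow hc (abs_nonneg _)]
  simp [abs_mul, abs_of_nonneg hc]

lemma ofReal_abs_rpow_le_powSum (α : ℝ) (k : Fin d → ℤ) (x : RField d) :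
    ENNReal.ofReal (|x k| ^ α) ≤ powSum α x :=
  ENNReal.le_tsum k

/-- The time-change formula for (the law of) a spectral tail process. -/
def TimeChange (ν : Measure (RField d)) (α : ℝ) : Prop :=
  ∀ h : RField d → ℝ≥0∞, Measurable h → ∀ k : Fin d → ℤ,
    ∫⁻ x, ENNReal.ofReal (|x k| ^ α) * h (recenter k x) ∂ν
      = ∫⁻ x, h x * (if x (-k) = 0 then 0 else 1) ∂ν

lemma tsum_mul_ite_eq_neg (c : ℝ≥0∞) (a : Fin d → ℤ) :
    ∑' k : Fin d → ℤ, c * (if a = -k then 1 else 0) = c := by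
  rw [tsum_eq_single (-a)]
  · simp
  · intro k hk
    rw [if_neg fun h => hk (by simp [h]), mul_zero]

lemma lintegral_eq_setLIntegral_recenterSum {ν : Measure (RField d)} {α : ℝ} (hα : 0 < α)
    (hTC : TimeChange ν α) (hν : ∀ᵐ x ∂ν, x ∈ l0set d ∧ |x 0| = 1) (F : FirstMaxData d)
    {h : RField d → ℝ≥0∞} (hh : Measurable h) :
    ∫⁻ x, h x ∂ν = ∫⁻ x in {x | F.Afm x = 0}, recenterSum α h x ∂ν := by
  have hA (k : Fin d → ℤ) :
      Measurable fun x : RField d => if F.Afm x = k then (1 : ℝ≥0∞) else 0 :=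
    Measurable.ite (F.measurableSet_Afm_eq k) measurable_const measurable_const
  calc ∫⁻ x, h x ∂ν
      = ∫⁻ x, ∑' k : Fin d → ℤ, h x * (if F.Afm x = -k then 1 else 0) ∂ν := by
        simp only [tsum_mul_ite_eq_neg]
    _ = ∑' k : Fin d → ℤ, ∫⁻ x, h x * (if F.Afm x = -k then 1 else 0) ∂ν :=
        lintegral_tsum fun k => (hh.mul (hA _)).aemeasurable
    _ = ∑' k : Fin d → ℤ,
          ∫⁻ x, (h x * (if F.Afm x = -k then 1 else 0)) * (if x (-k) = 0 then 0 else 1) ∂ν := by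
        refine tsum_congr fun k => lintegral_congr_ae ?_
        filter_upwards [hν] with x hx
        have hx0 : x ≠ 0 := by rintro rfl; simp at hx
        by_cases hk : F.Afm x = -k
        · have := F.apply_Afm_ne_zero hx.1 hx0
          rw [hk] at this
          simp [this]
        · simp [hk]
    _ = ∑' k : Fin d → ℤ, ∫⁻ x, ENNReal.ofReal (|x k| ^ α) *
          (h (recenter k x) * (if F.Afm (recenter k x) = -k then 1 else 0)) ∂ν :=
        tsum_congr fun k => (hTC _ (hh.mul (hA _)) k).symm
    _ = ∑' k : Fin d → ℤ, ∫⁻ x, ENNReal.ofReal (|x k| ^ α) * h (recenter k x) *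
          (if F.Afm x = 0 then 1 else 0) ∂ν := by
        refine tsum_congr fun k => lintegral_congr_ae ?_
        filter_upwards [hν] with x hx
        have hx0 : x ≠ 0 := by rintro rfl; simp at hx
        by_cases hk : x k = 0
        · simp [hk, Real.zero_rpow hα.ne']
        · have hc : 0 < |x k|⁻¹ := by positivity
          rw [recenter, F.Afm_smul_shift hx.1 hx0 hc, mul_assoc]
          simp [sub_eq_neg_self]
    _ = ∫⁻ x, recenterSum α h x * (if F.Afm x = 0 then 1 else 0) ∂ν := by
        simp only [recenterSum, ← ENNReal.tsum_mul_right]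
        exact (lintegral_tsum fun k => (((measurable_ofReal_abs_rpow α k).mul
          (hh.comp (measurable_recenter k))).mul (hA 0)).aemeasurable).symm
    _ = ∫⁻ x in {x | F.Afm x = 0}, recenterSum α h x ∂ν := by
        rw [← lintegral_indicator (F.measurableSet_Afm_eq 0)]
        refine lintegral_congr fun x => ?_
        simp [Set.indicator_apply]

lemma ae_powSum_ne_top {ν : Measure (RField d)} [IsProbabilityMeasure ν] {α : ℝ} (hα : 0 < α)
    (hTC : TimeChange ν α) (hν : ∀ᵐ x ∂ν, x ∈ l0set d ∧ |x 0| = 1) (F : FirstMaxData d) :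
    ∀ᵐ x ∂ν.restrict {x | F.Afm x = 0}, powSum α x ≠ ∞ := by
  have h1 := lintegral_eq_setLIntegral_recenterSum hα hTC hν F (h := 1) measurable_one
  simp only [recenterSum_one, Pi.one_apply, lintegral_one, measure_univ] at h1
  have := ae_lt_top (μ := ν.restrict {x | F.Afm x = 0}) (measurable_powSum α)
    (by rw [← h1]; simp)
  exact this.mono fun x hx => hx.ne

lemma measure_Afm_eq_zero_ne_zero {ν : Measure (RField d)} [IsProbabilityMeasure ν] {α : ℝ}
    (hα : 0 < α)
    (hTC : TimeChange ν α) (hν : ∀ᵐ x ∂ν, x ∈ l0set d ∧ |x 0| = 1) (F : FirstMaxData d) :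
    ν {x | F.Afm x = 0} ≠ 0 := by
  intro h0
  have h1 := lintegral_eq_setLIntegral_recenterSum hα hTC hν F (h := 1) measurable_one
  rw [setLIntegral_measure_zero _ _ h0] at h1
  simp at h1

/-- The sup-normalized functional `x ↦ h(x/‖x‖) ‖x‖^α / ∑ₖ |x_k|^α`. -/
def normFunctional (α : ℝ) (h : RField d → ℝ≥0∞) (x : RField d) : ℝ≥0∞ :=
  h ((supNorm x)⁻¹ • x) * (ENNReal.ofReal (supNorm x ^ α) / powSum α x)

lemma measurable_normFunctional (α : ℝ) {h : RField d → ℝ≥0∞} (hh : Measurable h) :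
    Measurable (normFunctional α h) :=
  (hh.comp (measurable_supNorm.inv.smul measurable_id)).mul
    ((measurable_supNorm.pow_const α).ennreal_ofReal.div (measurable_powSum α))

lemma recenterSum_normFunctional {α : ℝ} (hα : 0 < α) {h : RField d → ℝ≥0∞}
    (hinv : ShiftInvariantOn (l0set d) h) {x : RField d} (hx : x ∈ l0set d)
    (hx1 : supNorm x = 1) (h0 : powSum α x ≠ 0) (htop : powSum α x ≠ ∞) :
    recenterSum α (normFunctional α h) x = h x := by
  have key : ∀ k, ENNReal.ofReal (|x k| ^ α) * normFunctional α h (recenter k x)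
      = ENNReal.ofReal (|x k| ^ α) * (h x / powSum α x) := by
    intro k
    by_cases hk : x k = 0
    · simp [hk, Real.zero_rpow hα.ne']
    have hpos : 0 < |x k|⁻¹ := by positivity
    congr 1
    have hr0 : ENNReal.ofReal (|x k|⁻¹ ^ α) ≠ 0 := by
      rw [Ne, ENNReal.ofReal_eq_zero, not_le]; positivity
    rw [normFunctional, recenter, supNorm_smul hpos.le, supNorm_shift, hx1, mul_one, smul_smul,
      inv_mul_cancel₀ hpos.ne', one_smul, hinv x hx k, powSum_smul α hpos.le, powSum_shift,
      ← mul_div_assoc, mul_comm (h x), ENNReal.mul_div_mul_left _ _ hr0 ENNReal.ofReal_ne_top]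
  unfold recenterSum
  rw [tsum_congr key, ENNReal.tsum_mul_right]
  exact ENNReal.mul_div_cancel h0 htop

lemma lintegral_normFunctional {ν : Measure (RField d)} [IsProbabilityMeasure ν] {α : ℝ}
    (hα : 0 < α)
    (hTC : TimeChange ν α) (hν : ∀ᵐ x ∂ν, x ∈ l0set d ∧ |x 0| = 1) (F : FirstMaxData d)
    {h : RField d → ℝ≥0∞} (hh : Measurable h) (hinv : ShiftInvariantOn (l0set d) h) :
    ∫⁻ x, normFunctional α h x ∂ν = ∫⁻ x in {x | F.Afm x = 0}, h x ∂ν := by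
  rw [lintegral_eq_setLIntegral_recenterSum hα hTC hν F (measurable_normFunctional α hh)]
  apply lintegral_congr_ae
  filter_upwards [ae_powSum_ne_top hα hTC hν F, ae_restrict_of_ae hν,
    ae_restrict_mem (F.measurableSet_Afm_eq 0)] with x htop hx hA
  have hx0 : x ≠ 0 := by rintro rfl; simp at hx
  have hA : F.Afm x = 0 := hA
  have hs : supNorm x = 1 := by rw [← F.mem_argmax x hx.1 hx0, hA, hx.2]
  refine recenterSum_normFunctional hα hinv hx.1 hs ?_ htop
  have := ofReal_abs_rpow_le_powSum α 0 x
  rw [hx.2, Real.one_rpow, ENNReal.ofReal_one] at this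
  exact (one_pos.trans_le this).ne'

lemma recenterSum_indicator {α : ℝ} (hα : 0 < α) (F : FirstMaxData d) {h : RField d → ℝ≥0∞}
    (hinv : ShiftInvariantOn (l0set d) h) {x : RField d} (hx : x ∈ l0set d)
    (hx1 : supNorm x = 1) :
    recenterSum α ({x | F.Afm x = 0}.indicator h) x = h x := by
  have hx0 : x ≠ 0 := by
    rintro rfl
    simp [supNorm] at hx1
  have hA := F.mem_argmax x hx hx0
  rw [hx1] at hA
  unfold recenterSum
  rw [tsum_eq_single (F.Afm x)]
  · have : F.Afm (recenter (F.Afm x) x) = 0 := by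
      rw [recenter, F.Afm_smul_shift hx hx0 (by simp [hA]), sub_self]
    rw [Set.indicator_of_mem (by exact this), recenter, hA]
    simp [hinv x hx]
  · intro k hk
    by_cases hxk : x k = 0
    · simp [hxk, Real.zero_rpow hα.ne']
    · rw [Set.indicator_of_notMem, mul_zero]
      change ¬ F.Afm (recenter k x) = 0
      rw [recenter, F.Afm_smul_shift hx hx0 (by positivity)]
      exact fun h => hk (sub_eq_zero.1 h).symm

/-- The tail probability `P(V * t > 1)` of a Pareto(`α`)-distributed `V`. -/
def paretoTail (α t : ℝ) : ℝ≥0∞ := min 1 (ENNReal.ofReal (t ^ α))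

lemma measurable_paretoTail (α : ℝ) : Measurable (paretoTail α) :=
  measurable_const.min (measurable_id.pow_const α).ennreal_ofReal

lemma paretoTail_zero {α : ℝ} (hα : 0 < α) : paretoTail α 0 = 0 := by
  simp [paretoTail, Real.zero_rpow hα.ne']

lemma paretoTail_ne_zero {α t : ℝ} (ht : 0 < t) : paretoTail α t ≠ 0 := by
  have : 0 < t ^ α := by positivity
  simp [paretoTail, this]

lemma paretoTail_ne_top (α t : ℝ) : paretoTail α t ≠ ∞ :=
  ((min_le_left _ _).trans_lt one_lt_top).ne

lemma inv_paretoTail_inv_mul {α t : ℝ} (hα : 0 < α) (ht : 0 < t) :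
    (paretoTail α t⁻¹)⁻¹ * paretoTail α t = ENNReal.ofReal (t ^ α) := by
  rcases le_total t 1 with h | h
  · have h1 : t ^ α ≤ 1 := Real.rpow_le_one ht.le h hα.le
    have h2 : 1 ≤ t⁻¹ ^ α := Real.one_le_rpow ((one_le_inv₀ ht).2 h) hα.le
    rw [paretoTail, paretoTail, min_eq_left (by simpa using h2), min_eq_right (by simpa using h1)]
    simp
  · have h1 : 1 ≤ t ^ α := Real.one_le_rpow h hα.le
    have h2 : t⁻¹ ^ α ≤ 1 := Real.rpow_le_one (by positivity) (inv_le_one_of_one_le₀ h) hα.le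
    rw [paretoTail, paretoTail, min_eq_right (by simpa using h2), min_eq_left (by simpa using h1),
      Real.inv_rpow ht.le, ENNReal.ofReal_inv_of_pos (by positivity)]
    simp

lemma IsPareto.measure_one_lt_mul {Ω : Type*} [MeasurableSpace Ω] {μ : Measure Ω}
    [IsProbabilityMeasure μ] {V : Ω → ℝ} {α : ℝ} (hα : 0 < α) (hV : IsPareto μ V α) {t : ℝ}
    (ht : 0 ≤ t) : μ {ω | 1 < V ω * t} = paretoTail α t := by
  rcases ht.eq_or_lt with rfl | ht
  · simp [paretoTail_zero hα, zero_le_one.not_gt]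
  have hset : {ω | 1 < V ω * t} = {ω | t⁻¹ < V ω} := by
    ext ω
    simp [inv_lt_iff_one_lt_mul₀ ht]
  rw [hset, paretoTail]
  rcases le_total t 1 with h | h
  · rw [hV _ ((one_le_inv₀ ht).2 h), Real.inv_rpow ht.le, Real.rpow_neg ht.le, inv_inv, min_eq_right]
    simpa using Real.rpow_le_one ht.le h hα.le
  · rw [min_eq_left (by simpa using Real.one_le_rpow h hα.le)]
    refine le_antisymm prob_le_one ?_
    have h1 := hV 1 le_rfl
    rw [Real.one_rpow, ENNReal.ofReal_one] at h1
    rw [← h1]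
    exact measure_mono fun ω (hω : 1 < V ω) => (inv_le_one_of_one_le₀ h).trans_lt hω

lemma measurable_exIndGT (s : ℝ) (k : Fin d → ℤ) : Measurable (exIndGT (d := d) s k) :=
  Measurable.ite (measurableSet_lt measurable_const (measurable_pi_apply k).abs)
    measurable_const measurable_const

lemma lintegral_mul_exIndGT_of_indepFun {Ω : Type*} [MeasurableSpace Ω] {μ : Measure Ω}
    [IsProbabilityMeasure μ] {V : Ω → ℝ} {α : ℝ} (hα : 0 < α) (hV : IsPareto μ V α)
    (hVm : Measurable V) (hV0 : ∀ᵐ ω ∂μ, 1 < V ω) {Θ : Ω → RField d} (hΘ : Measurable Θ)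
    (hind : IndepFun V Θ μ)
    {f : RField d → ℝ≥0∞} (hf : Measurable f) (k : Fin d → ℤ) :
    ∫⁻ ω, f (Θ ω) * exIndGT 1 k (V ω • Θ ω) ∂μ
      = ∫⁻ x, f x * paretoTail α |x k| ∂(μ.map Θ) := by
  have hprod := (indepFun_iff_map_prod_eq_prod_map_map hVm.aemeasurable hΘ.aemeasurable).1 hind
  have : IsProbabilityMeasure (μ.map Θ) := Measure.isProbabilityMeasure_map hΘ.aemeasurable
  have : IsProbabilityMeasure (μ.map V) := Measure.isProbabilityMeasure_map hVm.aemeasurable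
  have hset : MeasurableSet {p : ℝ × RField d | 1 < p.1 * |p.2 k|} :=
    measurableSet_lt measurable_const
      (measurable_fst.mul ((measurable_pi_apply k).comp measurable_snd).abs)
  have hm : Measurable fun p : ℝ × RField d =>
      f p.2 * {p : ℝ × RField d | 1 < p.1 * |p.2 k|}.indicator 1 p :=
    (hf.comp measurable_snd).mul (measurable_one.indicator hset)
  calc ∫⁻ ω, f (Θ ω) * exIndGT 1 k (V ω • Θ ω) ∂μ
      = ∫⁻ ω, f (Θ ω) * {p : ℝ × RField d | 1 < p.1 * |p.2 k|}.indicator 1 (V ω, Θ ω) ∂μ := by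
        refine lintegral_congr_ae ?_
        filter_upwards [hV0] with ω hω
        simp [exIndGT, Set.indicator_apply, abs_mul, abs_of_pos (one_pos.trans hω)]
    _ = ∫⁻ p, f p.2 * {p : ℝ × RField d | 1 < p.1 * |p.2 k|}.indicator 1 p
          ∂((μ.map V).prod (μ.map Θ)) := by
        rw [← hprod, lintegral_map hm (hVm.prodMk hΘ)]
    _ = ∫⁻ x, f x * paretoTail α |x k| ∂(μ.map Θ) := by
        rw [lintegral_prod_symm' _ hm]
        refine lintegral_congr fun x => ?_
        have hs : MeasurableSet {v : ℝ | 1 < v * |x k|} :=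
          measurableSet_lt measurable_const (measurable_id.mul_const _)
        have hi : ∀ v : ℝ,
            {p : ℝ × RField d | 1 < p.1 * |p.2 k|}.indicator (1 : ℝ × RField d → ℝ≥0∞) (v, x)
            = {v : ℝ | 1 < v * |x k|}.indicator 1 v := fun v => by simp [Set.indicator_apply]
        simp only [hi]
        rw [lintegral_const_mul _ (measurable_one.indicator hs), lintegral_indicator_one hs,
          Measure.map_apply hVm hs, ← hV.measure_one_lt_mul hα (abs_nonneg _)]
        rfl

lemma timeChange_map {Ω : Type*} [MeasurableSpace Ω] {μ : Measure Ω}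
    [IsProbabilityMeasure μ] {V : Ω → ℝ} {α : ℝ} (hα : 0 < α) (hV : IsPareto μ V α)
    (hVm : Measurable V) (hV0 : ∀ᵐ ω ∂μ, 1 < V ω) {Θ : Ω → RField d} (hΘ : Measurable Θ)
    (hΘ0 : ∀ᵐ ω ∂μ, |Θ ω 0| = 1) (hind : IndepFun V Θ μ) {Y : Ω → RField d}
    (hY : ∀ᵐ ω ∂μ, Y ω = V ω • Θ ω) (hTI : TailIdentity μ Y) :
    TimeChange (μ.map Θ) α := by
  have hrec : ∀ k, ∀ᵐ ω ∂μ, recenter k (Y ω) = recenter k (Θ ω) := by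
    intro k
    filter_upwards [hY, hV0] with ω h1 h2
    have h3 : 0 < V ω := one_pos.trans h2
    rw [h1, recenter, recenter, shift_smul, smul_smul]
    congr 1
    simp only [Pi.smul_apply, smul_eq_mul, abs_mul, abs_of_pos h3]
    field_simp
  have hrec0 : ∀ᵐ ω ∂μ, recenter 0 (Θ ω) = Θ ω := by
    filter_upwards [hΘ0] with ω h
    ext i
    simp [recenter, shift, h]
  have step : ∀ f : RField d → ℝ≥0∞, Measurable f → ∀ k : Fin d → ℤ,
      ∫⁻ x, f (recenter k x) * paretoTail α |x k| ∂(μ.map Θ)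
        = ∫⁻ x, f x * paretoTail α |x (-k)| ∂(μ.map Θ) := by
    intro f hf k
    rw [← lintegral_mul_exIndGT_of_indepFun hα hV hVm hV0 hΘ hind
        (f := fun x => f (recenter k x)) (hf.comp (measurable_recenter k)) k,
      ← lintegral_mul_exIndGT_of_indepFun hα hV hVm hV0 hΘ hind hf (-k)]
    have h := hTI (fun x => f (recenter 0 x)) (hf.comp (measurable_recenter 0)) k
    calc _ = ∫⁻ ω, f (recenter 0 (shift k (Y ω))) * exIndGT 1 k (Y ω) ∂μ := by
          refine lintegral_congr_ae ?_
          filter_upwards [hrec k, hY] with ω h1 h2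
          rw [← h2, ← h1]
          congr 2
          simp [recenter, shift_add, shift]
      _ = _ := h
      _ = _ := by
          refine lintegral_congr_ae ?_
          filter_upwards [hrec 0, hY, hrec0] with ω h1 h2 h3
          rw [← h2, h1, h3]
  have hν0 : ∀ᵐ x ∂(μ.map Θ), |x 0| = 1 :=
    (ae_map_iff hΘ.aemeasurable (measurableSet_eq_fun (measurable_pi_apply 0).abs
      measurable_const)).2 hΘ0
  intro h hh k
  have hs := step (fun x => h x * (paretoTail α |x (-k)|)⁻¹)
    (hh.mul ((measurable_paretoTail α).comp (measurable_pi_apply (-k)).abs).inv) k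
  refine Eq.trans (lintegral_congr_ae ?_) (hs.trans (lintegral_congr fun x => ?_))
  · filter_upwards [hν0] with x hx
    by_cases hk : x k = 0
    · simp [hk, Real.zero_rpow hα.ne', paretoTail_zero hα]
    · have h1 : |recenter k x (-k)| = |x k|⁻¹ := by
        simp [recenter, shift, abs_mul, hx]
      rw [h1, mul_assoc, inv_paretoTail_inv_mul hα (abs_pos.2 hk), mul_comm]
  · rw [mul_assoc]
    split_ifs with hk
    · simp [hk, paretoTail_zero hα]
    · rw [ENNReal.inv_mul_cancel (paretoTail_ne_zero (abs_pos.2 hk)) (paretoTail_ne_top _ _)]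

lemma tsum_exIndGT (x : RField d) :
    ∑' k : Fin d → ℤ, exIndGT 1 k x = ((excSet x).encard : ℝ≥0∞) := by
  rw [← ENNReal.tsum_set_one, tsum_subtype (excSet x) fun _ => (1 : ℝ≥0∞)]
  refine tsum_congr fun k => ?_
  simp [exIndGT, Set.indicator_apply, excSet]

lemma finite_excSet {x : RField d} (hx : x ∈ l0set d) : (excSet x).Finite := by
  have h : Tendsto (fun i => |x i|) cofinite (nhds 0) := hx
  have := h.eventually (gt_mem_nhds one_pos)
  exact (eventually_cofinite.1 this).subset fun k hk => not_lt.2 (le_of_lt hk)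

lemma lintegral_inv_encard_excSet {Ω : Type*} [MeasurableSpace Ω] {μ : Measure Ω}
    {Y : Ω → RField d} (hY : Measurable Y) (hTI : TailIdentity μ Y)
    (hl0 : ∀ᵐ ω ∂μ, Y ω ∈ l0set d ∧ 1 < |Y ω 0|) (F : FirstMaxData d) :
    ∫⁻ ω, ((excSet (Y ω)).encard : ℝ≥0∞)⁻¹ ∂μ = μ {ω | F.Afm (Y ω) = 0} := by
  have hN : Measurable fun x : RField d => ((excSet x).encard : ℝ≥0∞) := by
    simp only [← tsum_exIndGT]
    exact Measurable.tsum fun k => measurable_exIndGT 1 k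
  have hA (k : Fin d → ℤ) :
      Measurable fun x : RField d => if F.Afm x = k then (1 : ℝ≥0∞) else 0 :=
    Measurable.ite (F.measurableSet_Afm_eq k) measurable_const measurable_const
  have hNA (k : Fin d → ℤ) := hN.inv.mul (hA k)
  have hshift (k : Fin d → ℤ) (x : RField d) : (excSet (shift k x)).encard = (excSet x).encard :=
    (Equiv.addRight k).bijective.injective.encard_image (excSet (shift k x)) ▸ by
      congr 1
      ext i
      simp [excSet, shift]
  calc ∫⁻ ω, ((excSet (Y ω)).encard : ℝ≥0∞)⁻¹ ∂μ
      = ∫⁻ ω, ∑' k : Fin d → ℤ,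
          ((excSet (Y ω)).encard : ℝ≥0∞)⁻¹ * (if F.Afm (Y ω) = -k then 1 else 0) ∂μ := by
        simp only [tsum_mul_ite_eq_neg]
    _ = ∑' k : Fin d → ℤ, ∫⁻ ω,
          ((excSet (Y ω)).encard : ℝ≥0∞)⁻¹ * (if F.Afm (Y ω) = -k then 1 else 0) ∂μ :=
        lintegral_tsum fun k => ((hNA _).comp hY).aemeasurable
    _ = ∑' k : Fin d → ℤ, ∫⁻ ω, ((excSet (Y ω)).encard : ℝ≥0∞)⁻¹ *
          (if F.Afm (Y ω) = -k then 1 else 0) * exIndGT 1 (-k) (Y ω) ∂μ := by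
        refine tsum_congr fun k => lintegral_congr_ae ?_
        filter_upwards [hl0] with ω hω
        have hx0 : Y ω ≠ 0 := by
          intro h
          simp [h, zero_lt_one.not_gt] at hω
        by_cases hk : F.Afm (Y ω) = -k
        · have h1 := F.mem_argmax _ hω.1 hx0
          rw [hk] at h1
          have h2 : 1 < |Y ω (-k)| := h1 ▸ hω.2.trans_le (abs_le_supNorm hω.1 0)
          simp [exIndGT, h2]
        · simp [hk]
    _ = ∑' k : Fin d → ℤ, ∫⁻ ω, ((excSet (shift k (Y ω))).encard : ℝ≥0∞)⁻¹ *
          (if F.Afm (shift k (Y ω)) = -k then 1 else 0) * exIndGT 1 k (Y ω) ∂μ :=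
        tsum_congr fun k => (hTI _ (hNA (-k)) k).symm
    _ = ∑' k : Fin d → ℤ, ∫⁻ ω, ((excSet (Y ω)).encard : ℝ≥0∞)⁻¹ *
          (if F.Afm (Y ω) = 0 then 1 else 0) * exIndGT 1 k (Y ω) ∂μ := by
        refine tsum_congr fun k => lintegral_congr_ae ?_
        filter_upwards [hl0] with ω hω
        have hx0 : Y ω ≠ 0 := by
          intro h
          simp [h, zero_lt_one.not_gt] at hω
        have := F.Afm_smul_shift hω.1 hx0 one_pos k
        rw [one_smul] at this
        simp [hshift, this, sub_eq_neg_self]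
    _ = ∫⁻ ω, ((excSet (Y ω)).encard : ℝ≥0∞)⁻¹ *
          (if F.Afm (Y ω) = 0 then 1 else 0) * ((excSet (Y ω)).encard : ℝ≥0∞) ∂μ := by
        simp only [← tsum_exIndGT (Y _), ← ENNReal.tsum_mul_left]
        simp only [tsum_exIndGT (Y _)]
        exact (lintegral_tsum fun k =>
          (((hNA 0).mul (measurable_exIndGT 1 k)).comp hY).aemeasurable).symm
    _ = ∫⁻ ω, {ω | F.Afm (Y ω) = 0}.indicator 1 ω ∂μ := by
        refine lintegral_congr_ae ?_
        filter_upwards [hl0] with ω hω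
        have h1 : ((excSet (Y ω)).encard : ℝ≥0∞) ≠ ∞ := by
          simpa using finite_excSet hω.1
        have h2 : ((excSet (Y ω)).encard : ℝ≥0∞) ≠ 0 := by
          simpa using Set.nonempty_iff_ne_empty.1 ⟨0, hω.2⟩
        rw [mul_right_comm, ENNReal.inv_mul_cancel h2 h1]
        simp [Set.indicator_apply]
    _ = μ {ω | F.Afm (Y ω) = 0} :=
        lintegral_indicator_one (hY (F.measurableSet_Afm_eq 0))

open Classical in
/-- **characterization of representatives of the anchored spectral tail
process.** Let `Y` be a tail process of index `α > 0` with finitely many exceedance-points,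
`Θ = Y/|Y_0|`, `ϑ = E[1/|e(Y)|]`, and let `Q` be a random element of `l₀` with `‖Q‖ = 1`
a.s. and `E[Σ_k |Q_k|^α] < ∞`. The following are equivalent:
(i) `Q` is a representative of the anchored spectral tail process;
(ii) `E[h(Θ)] = E[Σ_k h(θ_k Q/|Q_k|)|Q_k|^α] / E[Σ_k |Q_k|^α]` for all measurable `h ≥ 0`;
(iii) `E[h(Q)] = ϑ⁻¹ E[h(Θ/‖Θ‖) ‖Θ‖^α / Σ_k |Θ_k|^α]` for all shift-invariant measurable
`h ≥ 0`. -/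
theorem spectral_representative_characterization
    {Ω : Type*} [MeasurableSpace Ω] (μ : Measure Ω) [IsProbabilityMeasure μ]
    {Ω₂ : Type*} [MeasurableSpace Ω₂] (μ₂ : Measure Ω₂) [IsProbabilityMeasure μ₂]
    (Y : Ω → RField d) (hY : Measurable Y) (hTI : TailIdentity μ Y)
    (α : ℝ) (hα : 0 < α) (hPar : IsPareto μ (fun ω => |Y ω 0|) α)
    (Θ : Ω → RField d) (hΘdef : Θ = fun ω => fun i => Y ω i / |Y ω 0|)
    (hind : IndepFun (fun ω => |Y ω 0|) Θ μ)
    (hl0 : ∀ᵐ ω ∂μ, Θ ω ∈ l0set d)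
    (ϑ : ℝ≥0∞) (hϑ : ϑ = ∫⁻ ω, ((excSet (Y ω)).encard)⁻¹ ∂μ)
    (F : FirstMaxData d)
    (Q : Ω₂ → RField d) (hQ : Measurable Q) (hQl0 : ∀ᵐ ω ∂μ₂, Q ω ∈ l0set d)
    (hQnorm : ∀ᵐ ω ∂μ₂, supNorm (Q ω) = 1)
    (hQfin : ∫⁻ ω, ∑' k : Fin d → ℤ, ENNReal.ofReal (|Q ω k| ^ α) ∂μ₂ ≠ ⊤) :
    (IsSpectralRep μ Θ F μ₂ Q ↔
      (∀ h : RField d → ℝ≥0∞, Measurable h →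
        ∫⁻ ω, h (Θ ω) ∂μ
          = (∫⁻ ω, ∑' k : Fin d → ℤ, ENNReal.ofReal (|Q ω k| ^ α) ∂μ₂)⁻¹ *
              ∫⁻ ω, ∑' k : Fin d → ℤ,
                (if Q ω k = 0 then 0
                  else ENNReal.ofReal (|Q ω k| ^ α) *
                    h (|Q ω k|⁻¹ • shift k (Q ω))) ∂μ₂)) ∧
    ((∀ h : RField d → ℝ≥0∞, Measurable h →
        ∫⁻ ω, h (Θ ω) ∂μ
          = (∫⁻ ω, ∑' k : Fin d → ℤ, ENNReal.ofReal (|Q ω k| ^ α) ∂μ₂)⁻¹ *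
              ∫⁻ ω, ∑' k : Fin d → ℤ,
                (if Q ω k = 0 then 0
                  else ENNReal.ofReal (|Q ω k| ^ α) *
                    h (|Q ω k|⁻¹ • shift k (Q ω))) ∂μ₂) ↔
      (∀ h : RField d → ℝ≥0∞, Measurable h → ShiftInvariantOn (l0set d) h →
        ∫⁻ ω, h (Q ω) ∂μ₂
          = ϑ⁻¹ * ∫⁻ ω, h ((supNorm (Θ ω))⁻¹ • Θ ω) *
              (ENNReal.ofReal (supNorm (Θ ω) ^ α) /
                ∑' k : Fin d → ℤ, ENNReal.ofReal (|Θ ω k| ^ α)) ∂μ)) := by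
  set ν := μ.map Θ with hν_def
  have hV0 : ∀ᵐ ω ∂μ, 1 < |Y ω 0| := by
    have h := hPar 1 le_rfl
    rw [Real.one_rpow, ENNReal.ofReal_one] at h
    exact (mem_ae_iff_prob_eq_one (measurableSet_lt measurable_const
      ((measurable_pi_apply 0).comp hY).abs)).2 h
  have hVm : Measurable fun ω => |Y ω 0| := ((measurable_pi_apply 0).comp hY).abs
  have hΘ : Measurable Θ := by
    rw [hΘdef]
    exact measurable_pi_lambda _ fun i => ((measurable_pi_apply i).comp hY).div hVm
  have hYΘ : ∀ᵐ ω ∂μ, Y ω = |Y ω 0| • Θ ω := by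
    filter_upwards [hV0] with ω hω
    ext i
    have h : |Y ω 0| ≠ 0 := (one_pos.trans hω).ne'
    simp only [hΘdef, Pi.smul_apply, smul_eq_mul]
    field_simp
  have hΘ0 : ∀ᵐ ω ∂μ, |Θ ω 0| = 1 := by
    filter_upwards [hV0] with ω hω
    have h : |Y ω 0| ≠ 0 := (one_pos.trans hω).ne'
    simp [hΘdef, abs_div, div_self h]
  have hTC : TimeChange ν α := timeChange_map hα hPar hVm hV0 hΘ hΘ0 hind hYΘ hTI
  have hν : ∀ᵐ x ∂ν, x ∈ l0set d ∧ |x 0| = 1 :=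
    (ae_map_iff hΘ.aemeasurable (measurableSet_l0set.inter
      (measurableSet_eq_fun (measurable_pi_apply 0).abs measurable_const))).2 (hl0.and hΘ0)
  have : IsProbabilityMeasure ν := Measure.isProbabilityMeasure_map hΘ.aemeasurable
  have hmA := F.measurableSet_Afm_eq 0
  have hϑν : ϑ = ν {x | F.Afm x = 0} := by
    rw [hϑ, lintegral_inv_encard_excSet hY hTI ?_ F, Measure.map_apply hΘ hmA]
    · apply measure_congr
      filter_upwards [hYΘ, hV0, hl0, hΘ0] with ω h1 h2 h3 h4
      have h5 : Θ ω ≠ 0 := fun h => by simp [h] at h4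
      have h6 := F.Afm_smul h3 h5 (one_pos.trans h2)
      rw [← h1] at h6
      exact congrArg (· = 0) h6
    · filter_upwards [hYΘ, hV0, hl0] with ω h1 h2 h3
      exact ⟨h1 ▸ smul_mem_l0set h3 _, h2⟩
  have hϑ0 : ϑ ≠ 0 := hϑν ▸ measure_Afm_eq_zero_ne_zero hα hTC hν F
  have hϑtop : ϑ ≠ ∞ := hϑν ▸ measure_ne_top _ _
  have hcond : ∀ h : RField d → ℝ≥0∞, ∫⁻ x, h x ∂(ProbabilityTheory.cond ν {x | F.Afm x = 0})
      = ϑ⁻¹ * ∫⁻ x in {x | F.Afm x = 0}, h x ∂ν := fun h => by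
    rw [ProbabilityTheory.cond, lintegral_smul_measure, hϑν, smul_eq_mul]
  have hsum : ∀ h : RField d → ℝ≥0∞, ∀ x : RField d, (∑' k : Fin d → ℤ, (if x k = 0 then 0
      else ENNReal.ofReal (|x k| ^ α) * h (|x k|⁻¹ • shift k x))) = recenterSum α h x := by
    refine fun h x => tsum_congr fun k => ?_
    split_ifs with hk
    · simp [hk, Real.zero_rpow hα.ne']
    · rfl
  have hQ01 : ∀ᵐ ω ∂μ₂, Q ω ∈ l0set d ∧ supNorm (Q ω) = 1 := hQl0.and hQnorm
  have hrep : IsSpectralRep μ Θ F μ₂ Q ↔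
      (∀ h : RField d → ℝ≥0∞, Measurable h → ShiftInvariantOn (l0set d) h →
        ∫⁻ ω, h (Q ω) ∂μ₂
          = ϑ⁻¹ * ∫⁻ ω, h ((supNorm (Θ ω))⁻¹ • Θ ω) *
              (ENNReal.ofReal (supNorm (Θ ω) ^ α) /
                ∑' k : Fin d → ℤ, ENNReal.ofReal (|Θ ω k| ^ α)) ∂μ) := by
    refine forall₃_congr fun h hh hinv => ?_
    rw [hcond, ← lintegral_normFunctional hα hTC hν F hh hinv,
      lintegral_map (measurable_normFunctional α hh) hΘ]
    rfl
  have hmain : IsSpectralRep μ Θ F μ₂ Q ↔ ∀ h : RField d → ℝ≥0∞, Measurable h →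
      ∫⁻ x, h x ∂ν
        = (∫⁻ ω, powSum α (Q ω) ∂μ₂)⁻¹ * ∫⁻ ω, recenterSum α h (Q ω) ∂μ₂ := by
    constructor
    · intro hR
      have key : ∀ h : RField d → ℝ≥0∞, Measurable h →
          ∫⁻ ω, recenterSum α h (Q ω) ∂μ₂ = ϑ⁻¹ * ∫⁻ x, h x ∂ν := by
        intro h hh
        rw [hR _ (measurable_recenterSum α hh) fun x _ k => recenterSum_shift α h k x, hcond,
          lintegral_eq_setLIntegral_recenterSum hα hTC hν F hh]
      have h1 := key 1 measurable_one
      simp only [recenterSum_one, Pi.one_apply, lintegral_one, measure_univ, mul_one] at h1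
      intro h hh
      rw [h1, key h hh, ← mul_assoc, inv_inv, ENNReal.mul_inv_cancel hϑ0 hϑtop, one_mul]
    · intro hR
      have key : ∀ h : RField d → ℝ≥0∞, Measurable h → ShiftInvariantOn (l0set d) h →
          ∫⁻ x in {x | F.Afm x = 0}, h x ∂ν
            = (∫⁻ ω, powSum α (Q ω) ∂μ₂)⁻¹ * ∫⁻ ω, h (Q ω) ∂μ₂ := by
        intro h hh hinv
        rw [← lintegral_indicator hmA, hR _ (hh.indicator hmA)]
        congr 1
        refine lintegral_congr_ae ?_
        filter_upwards [hQ01] with ω hω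
        exact recenterSum_indicator hα F hinv hω.1 hω.2
      have h1 := key 1 measurable_one fun _ _ _ => rfl
      simp only [Pi.one_apply, lintegral_one, measure_univ, mul_one, Measure.restrict_apply_univ,
        ← hϑν] at h1
      intro h hh hinv
      rw [hcond, key h hh hinv, ← h1, ← mul_assoc, ENNReal.inv_mul_cancel hϑ0 hϑtop, one_mul]
  have hii : (∀ h : RField d → ℝ≥0∞, Measurable h →
        ∫⁻ ω, h (Θ ω) ∂μ
          = (∫⁻ ω, ∑' k : Fin d → ℤ, ENNReal.ofReal (|Q ω k| ^ α) ∂μ₂)⁻¹ *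
              ∫⁻ ω, ∑' k : Fin d → ℤ,
                (if Q ω k = 0 then 0
                  else ENNReal.ofReal (|Q ω k| ^ α) *
                    h (|Q ω k|⁻¹ • shift k (Q ω))) ∂μ₂) ↔ IsSpectralRep μ Θ F μ₂ Q := by
    rw [hmain]
    refine forall₂_congr fun h hh => ?_
    simp only [hsum]
    rw [lintegral_map hh hΘ]
    rfl
  exact ⟨hii.symm, hii.trans hrep⟩
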